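/- Let r and s be integers with r ≥ 2 and s ≥ 2, let P be a finite (𝐫+𝐬)-free poset of width w, and let C_1, …, C_m be a First-Fit chain partition of P. Then m ≤ 8(r−1)(s−1)w; that is, the First-Fit algorithm partitions every (𝐫+𝐬)-free poset of width w into at most 8(r−1)(s−1)w chains. -/

import Mathlib

open Classical in
/-- Mirsky-type bound: chains at most `k`, antichains at most `w`, so size at most `k * w`. -/
theorem ffAux_mirsky {α : Type*} [PartialOrder α] (w : ℕ)
    (hw : ∀ A : Finset α, IsAntichain (· ≤ ·) (A : Set α) → A.card ≤ w) (k : ℕ) :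
    ∀ F : Finset α, (∀ T : Finset α, T ⊆ F → IsChain (· ≤ ·) (T : Set α) → T.card ≤ k) →
      F.card ≤ k * w := by
  induction k with
  | zero =>
    intro F hF
    have : F = ∅ := by
      by_contra hne
      obtain ⟨x, hx⟩ := Finset.nonempty_iff_ne_empty.mpr hne
      have := hF {x} (by simpa using hx) (by simp)
      simp at this
    simp [this]
  | succ k ih =>
    intro F hF
    set M := F.filter (fun x => ∀ y ∈ F, ¬ y < x) with hM
    have hMa : M.card ≤ w := by
      apply hw
      intro x hx y hy hne hle
      simp only [hM, Finset.coe_filter, Set.mem_ofPred_eq] at hx hy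
      exact hy.2 x hx.1 (lt_of_le_of_ne hle hne)
    have h2 : (F \ M).card ≤ k * w := by
      apply ih
      intro T hT hTc
      rcases T.eq_empty_or_nonempty with rfl | hne
      · simp
      obtain ⟨x, hx⟩ := Finset.exists_minimal hne
      have hxF := hT hx.1
      simp only [hM, Finset.mem_sdiff, Finset.mem_filter, not_and, not_forall, not_not] at hxF
      obtain ⟨y, hy, hyx⟩ := hxF.2 hxF.1
      have hlow : ∀ z ∈ T, y < z := by
        intro z hz
        rcases eq_or_ne x z with rfl | hxz
        · exact hyx
        rcases hTc hx.1 hz hxz with h | h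
        · exact lt_of_lt_of_le hyx h
        · exact lt_of_lt_of_le hyx (hx.2 hz h)
      have hyT : y ∉ T := fun h => lt_irrefl _ (hlow y h)
      have := hF (insert y T) (by
        intro z hz
        rcases Finset.mem_insert.mp hz with rfl | hz
        · exact hy
        · exact (Finset.mem_sdiff.mp (hT hz)).1) (by
        rw [Finset.coe_insert]
        exact hTc.insert (fun z hz _ => Or.inl (hlow z hz).le))
      rw [Finset.card_insert_of_notMem hyT] at this
      omega
    have h3 : F.card = (F \ M).card + M.card := by
      rw [Finset.card_sdiff_add_card_eq_card (Finset.filter_subset _ _)]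
    rw [h3, add_mul, one_mul]
    omega

open Classical in
/-- The column construction: First-Fit on interval representations. -/
theorem ffAux_column {α : Type*} (N m K : ℕ) (I : α → Set ℕ) (c : α → ℕ)
    (hbd : ∀ x, ∀ t ∈ I x, t < N) (hconn : ∀ x, (I x).OrdConnected)
    (hne : ∀ x, (I x).Nonempty)
    (hFF : ∀ x, ∀ i < c x, ∃ y, c y = i ∧ (I x ∩ I y).Nonempty)
    (hm : ∃ x, c x + 1 = m)
    (hK : ∀ t, ∀ F : Finset α, (∀ x ∈ F, t ∈ I x) → F.card ≤ K) : m ≤ 8 * K := by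
  set R : ℕ → ℕ → Prop := fun i t => ∃ x, c x = i ∧ t ∈ I x with hR
  set A : ℕ → ℕ → ℕ := fun h t => ((Finset.range h).filter (fun i => R i t)).card with hA
  have hAK : ∀ h t, A h t ≤ K := by
    intro h t
    have hch : ∀ i : ℕ, ∃ x : α, R i t → (c x = i ∧ t ∈ I x) := by
      intro i
      by_cases hi : R i t
      · obtain ⟨x, hx⟩ := hi
        exact ⟨x, fun _ => hx⟩
      · obtain ⟨x, _⟩ := hm
        exact ⟨x, fun h => absurd h hi⟩
    choose f hf using hch
    have hinj : Set.InjOn f ((Finset.range h).filter (fun i => R i t) : Finset ℕ) := by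
      intro i hi j hj hij
      simp only [Finset.coe_filter, Set.mem_ofPred_eq] at hi hj
      rw [← (hf i hi.2).1, ← (hf j hj.2).1, hij]
    rw [hA]
    simp only
    rw [← Finset.card_image_of_injOn hinj]
    apply hK t
    intro x hx
    obtain ⟨i, hi, rfl⟩ := Finset.mem_image.mp hx
    exact (hf i (Finset.mem_filter.mp hi).2).2
  have hAs : ∀ h t, A (h+1) t = A h t + if R h t then 1 else 0 := by
    intro h t
    simp only [hA, Finset.range_add_one, Finset.filter_insert]
    split_ifs with hh
    · rw [Finset.card_insert_of_notMem (by simp)]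
    · rfl
  have key : ∀ h, ∃ (S : Finset ℕ) (L Q : ℕ → ℕ),
      (∀ d ∈ S, h ≤ 4 * A h d + L d + Q d) ∧
      (∀ d ∈ S, 4 * L d ≤ h ∨ ∃ e ∈ S, e < d ∧ (∀ f ∈ S, f < d → f ≤ e) ∧
        4 * L d ≤ 4 * A h e + L e + Q e) ∧
      (∀ d ∈ S, 4 * Q d ≤ h ∨ ∃ e ∈ S, d < e ∧ (∀ f ∈ S, d < f → e ≤ f) ∧
        4 * Q d ≤ 4 * A h e + L e + Q e) ∧
      (∀ x, h ≤ c x + 1 → ∃ d ∈ S, d ∈ I x) := by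
    intro h
    induction h with
    | zero =>
      refine ⟨Finset.range N, fun _ => 0, fun _ => 0, ?_, ?_, ?_, ?_⟩
      · simp
      · simp
      · simp
      · intro x _
        obtain ⟨t, ht⟩ := hne x
        exact ⟨t, Finset.mem_range.mpr (hbd x t ht), ht⟩
    | succ h ih =>
      obtain ⟨S, L, Q, h1, h2, h3, h4⟩ := ih
      have h4' : ∀ x, h ≤ c x → ∃ d ∈ S, d ∈ I x := by
        intro x hx
        exact h4 x (by omega)
      set PL : ℕ → Prop := fun d => ∃ e ∈ S, e < d ∧ (∀ f ∈ S, f < d → f ≤ e) ∧ R h e with hPL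
      set PQ : ℕ → Prop := fun d => ∃ e ∈ S, d < e ∧ (∀ f ∈ S, d < f → e ≤ f) ∧ R h e with hPQ
      set L' : ℕ → ℕ := fun d => L d + if PL d then 1 else 0 with hL'
      set Q' : ℕ → ℕ := fun d => Q d + if PQ d then 1 else 0 with hQ'
      have mL : ∀ d, L d ≤ L' d := fun d => Nat.le_add_right _ _
      have mQ : ∀ d, Q d ≤ Q' d := fun d => Nat.le_add_right _ _
      have mA : ∀ d, A h d ≤ A (h+1) d := fun d => by rw [hAs]; exact Nat.le_add_right _ _
      have alive : ∀ d ∈ S, (R h d ∨ PL d ∨ PQ d) → h + 1 ≤ 4 * A (h+1) d + L' d + Q' d := by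
        intro d hd hor
        have a1 := h1 d hd
        have a2 := mL d
        have a3 := mQ d
        have a4 := mA d
        rcases hor with hh | hh | hh
        · have := hAs h d
          rw [if_pos hh] at this
          omega
        · have : L' d = L d + 1 := by simp only [hL', if_pos hh]
          omega
        · have : Q' d = Q d + 1 := by simp only [hQ', if_pos hh]
          omega
      refine ⟨S.filter (fun d => h + 1 ≤ 4 * A (h+1) d + L' d + Q' d), L', Q', ?_, ?_, ?_, ?_⟩
      · intro d hd
        exact (Finset.mem_filter.mp hd).2
      · intro d hd
        have hdS := (Finset.mem_filter.mp hd).1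
        by_cases hp : PL d
        · obtain ⟨e, he, hed, hnear, hRe⟩ := id hp
          right
          refine ⟨e, Finset.mem_filter.mpr ⟨he, alive e he (Or.inl hRe)⟩, hed, ?_, ?_⟩
          · intro f hf; exact hnear f (Finset.mem_filter.mp hf).1
          · have b1 : L' d = L d + 1 := by simp only [hL', if_pos hp]
            have b2 := hAs h e
            rw [if_pos hRe] at b2
            have b3 := mL e
            have b4 := mQ e
            have b5 := h1 e he
            rcases h2 d hdS with hc | ⟨e', he', hed', hnear', hc⟩
            · omega
            · have : e = e' := le_antisymm (hnear' e he hed) (hnear e' he' hed')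
              subst this
              omega
        · have b1 : L' d = L d := by simp only [hL', if_neg hp, add_zero]
          rcases h2 d hdS with hc | ⟨e, he, hed, hnear, hc⟩
          · left; omega
          · have b3 := mL e
            have b4 := mQ e
            have b5 := mA e
            by_cases hal : h + 1 ≤ 4 * A (h+1) e + L' e + Q' e
            · right
              refine ⟨e, Finset.mem_filter.mpr ⟨he, hal⟩, hed, ?_, by omega⟩
              intro f hf; exact hnear f (Finset.mem_filter.mp hf).1
            · left; omega
      · intro d hd
        have hdS := (Finset.mem_filter.mp hd).1
        by_cases hp : PQ d
        · obtain ⟨e, he, hed, hnear, hRe⟩ := id hp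
          right
          refine ⟨e, Finset.mem_filter.mpr ⟨he, alive e he (Or.inl hRe)⟩, hed, ?_, ?_⟩
          · intro f hf; exact hnear f (Finset.mem_filter.mp hf).1
          · have b1 : Q' d = Q d + 1 := by simp only [hQ', if_pos hp]
            have b2 := hAs h e
            rw [if_pos hRe] at b2
            have b3 := mL e
            have b4 := mQ e
            have b5 := h1 e he
            rcases h3 d hdS with hc | ⟨e', he', hed', hnear', hc⟩
            · omega
            · have : e = e' := le_antisymm (hnear e' he' hed') (hnear' e he hed)
              subst this
              omega
        · have b1 : Q' d = Q d := by simp only [hQ', if_neg hp, add_zero]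
          rcases h3 d hdS with hc | ⟨e, he, hed, hnear, hc⟩
          · left; omega
          · have b3 := mL e
            have b4 := mQ e
            have b5 := mA e
            by_cases hal : h + 1 ≤ 4 * A (h+1) e + L' e + Q' e
            · right
              refine ⟨e, Finset.mem_filter.mpr ⟨he, hal⟩, hed, ?_, by omega⟩
              intro f hf; exact hnear f (Finset.mem_filter.mp hf).1
            · left; omega
      · intro x hx
        suffices hsuff : ∃ d ∈ S, d ∈ I x ∧ (R h d ∨ PL d ∨ PQ d) by
          obtain ⟨d, hd, hdI, hor⟩ := hsuff
          exact ⟨d, Finset.mem_filter.mpr ⟨hd, alive d hd hor⟩, hdI⟩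
        obtain ⟨d0, hd0, hd0I⟩ := h4' x (by omega)
        rcases Nat.lt_or_ge h (c x) with hlt | hge
        swap
        · exact ⟨d0, hd0, hd0I, Or.inl ⟨x, by omega, hd0I⟩⟩
        obtain ⟨y, hy, t, htx, hty⟩ := hFF x h hlt
        obtain ⟨z, hz, hzI⟩ := h4' y hy.ge
        by_contra hcon
        push Not at hcon
        have hno : ∀ d ∈ S, d ∈ I x → d ∉ I y := fun d hd hdx hdy =>
          (hcon d hd hdx).1 ⟨y, hy, hdy⟩
        have hzx : z ∉ I x := fun hzx => hno z hz hzx hzI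
        have hfne : (S.filter (fun d => d ∈ I x)).Nonempty :=
          ⟨d0, Finset.mem_filter.mpr ⟨hd0, hd0I⟩⟩
        rcases Nat.lt_or_ge z t with hzt | hzt
        · -- the friend lies to the left
          obtain ⟨b, hbmem, hbmin⟩ := Finset.exists_min_image _ id hfne
          obtain ⟨hbS, hbI⟩ := Finset.mem_filter.mp hbmem
          have htb : t < b := by
            by_contra hle
            push Not at hle
            rcases Nat.lt_or_ge b z with hbz | hbz
            · exact hzx ((hconn x).out hbI htx ⟨hbz.le, hzt.le⟩)
            · exact hno b hbS hbI ((hconn y).out hzI hty ⟨hbz, hle⟩)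
          have hgne : (S.filter (fun d => d < b)).Nonempty :=
            ⟨z, Finset.mem_filter.mpr ⟨hz, by omega⟩⟩
          obtain ⟨e, hemem, hemax⟩ := Finset.exists_max_image _ id hgne
          obtain ⟨heS, heb⟩ := Finset.mem_filter.mp hemem
          have hze : z ≤ e := hemax z (Finset.mem_filter.mpr ⟨hz, by omega⟩)
          refine (hcon b hbS hbI).2.1 ⟨e, heS, heb, ?_, y, hy, ?_⟩
          · intro f hf hfb
            exact hemax f (Finset.mem_filter.mpr ⟨hf, hfb⟩)
          · rcases Nat.lt_or_ge t e with hte | hte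
            · exfalso
              have : e ∈ I x := (hconn x).out htx hbI ⟨hte.le, heb.le⟩
              have := hbmin e (Finset.mem_filter.mpr ⟨heS, this⟩)
              simp only [id] at this
              omega
            · exact (hconn y).out hzI hty ⟨hze, hte⟩
        · obtain ⟨b, hbmem, hbmin⟩ := Finset.exists_max_image _ id hfne
          obtain ⟨hbS, hbI⟩ := Finset.mem_filter.mp hbmem
          have htb : b < t := by
            by_contra hle
            push Not at hle
            rcases Nat.lt_or_ge z b with hbz | hbz
            · exact hzx ((hconn x).out htx hbI ⟨hzt, hbz.le⟩)
            · exact hno b hbS hbI ((hconn y).out hty hzI ⟨hle, hbz⟩)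
          have hgne : (S.filter (fun d => b < d)).Nonempty :=
            ⟨z, Finset.mem_filter.mpr ⟨hz, by omega⟩⟩
          obtain ⟨e, hemem, hemax⟩ := Finset.exists_min_image _ id hgne
          obtain ⟨heS, heb⟩ := Finset.mem_filter.mp hemem
          have hze : e ≤ z := hemax z (Finset.mem_filter.mpr ⟨hz, by omega⟩)
          refine (hcon b hbS hbI).2.2 ⟨e, heS, heb, ?_, y, hy, ?_⟩
          · intro f hf hfb
            exact hemax f (Finset.mem_filter.mpr ⟨hf, hfb⟩)
          · rcases Nat.lt_or_ge e t with hte | hte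
            · exfalso
              have : e ∈ I x := (hconn x).out hbI htx ⟨heb.le, hte.le⟩
              have := hbmin e (Finset.mem_filter.mpr ⟨heS, this⟩)
              simp only [id] at this
              omega
            · exact (hconn y).out hty hzI ⟨hte, hze⟩
  obtain ⟨S, L, Q, h1, h2, h3, h4⟩ := key m
  obtain ⟨x, hx⟩ := hm
  have hSne : S.Nonempty := by
    obtain ⟨d, hd⟩ := h4 x hx.ge
    exact ⟨d, hd.1⟩
  obtain ⟨d, hd, hmax⟩ := Finset.exists_max_image S (fun d => 4 * A m d + L d + Q d) hSne
  have a1 := h1 d hd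
  have a2 := hAK m d
  have a3 : 4 * L d ≤ 4 * A m d + L d + Q d := by
    rcases h2 d hd with h | ⟨e, he, _, _, h⟩
    · omega
    · exact h.trans (hmax e he)
  have a4 : 4 * Q d ≤ 4 * A m d + L d + Q d := by
    rcases h3 d hd with h | ⟨e, he, _, _, h⟩
    · omega
    · exact h.trans (hmax e he)
  omega

/-- A least element of a nonempty finite chain. -/
theorem ffAux_least {α : Type*} [PartialOrder α] (T : Finset α)
    (hT : IsChain (· ≤ ·) (T : Set α)) (hne : T.Nonempty) : ∃ x ∈ T, ∀ y ∈ T, x ≤ y := by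
  obtain ⟨x, hx⟩ := Finset.exists_minimal hne
  refine ⟨x, hx.1, fun y hy => ?_⟩
  rcases hT.total hx.1 hy with h | h
  · exact h
  · exact hx.2 hy h

/-- A greatest element of a nonempty finite chain. -/
theorem ffAux_greatest {α : Type*} [PartialOrder α] (T : Finset α)
    (hT : IsChain (· ≤ ·) (T : Set α)) (hne : T.Nonempty) : ∃ x ∈ T, ∀ y ∈ T, y ≤ x := by
  obtain ⟨x, hx⟩ := Finset.exists_maximal hne
  refine ⟨x, hx.1, fun y hy => ?_⟩
  rcases hT.total hx.1 hy with h | h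
  · exact hx.2 hy h
  · exact h

/-- No incomparable chains of sizes `r` and `s`. -/
def ffFree (α : Type*) [PartialOrder α] (r s : ℕ) : Prop :=
  ∀ A B : Finset α, A.card = r → B.card = s → IsChain (· ≤ ·) (A : Set α) →
    IsChain (· ≤ ·) (B : Set α) → (∀ a ∈ A, ∀ b ∈ B, ¬ a ≤ b ∧ ¬ b ≤ a) → False

/-- An interval representation covering the incomparability graph with bags of size at most `K`. -/
def ffRep (α : Type*) [PartialOrder α] (K : ℕ) : Prop :=
  ∃ (N : ℕ) (I : α → Set ℕ), (∀ x, ∀ t ∈ I x, t < N) ∧ (∀ x, (I x).OrdConnected) ∧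
    (∀ x, (I x).Nonempty) ∧ (∀ x y, ¬ x ≤ y → ¬ y ≤ x → (I x ∩ I y).Nonempty) ∧
    (∀ t, ∀ F : Finset α, (∀ x ∈ F, t ∈ I x) → F.card ≤ K)

open Classical in
theorem ffAux_sigma (α : Type*) [PartialOrder α] [Fintype α] :
    ∃ D : α → Finset α, (∀ x y, y ∈ D x ↔ y < x) ∧ (∀ x y, x < y → (D x).card < (D y).card) ∧
      ∀ x, (D x).card < Fintype.card α + 1 := by
  refine ⟨fun x => Finset.univ.filter (fun y => y < x), by simp, ?_, ?_⟩
  · intro x y hxy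
    apply Finset.card_lt_card
    refine Finset.ssubset_iff_subset_ne.mpr ⟨?_, ?_⟩
    · intro z hz
      simp only [Finset.mem_filter, Finset.mem_univ, true_and] at hz ⊢
      exact hz.trans hxy
    · intro heq
      have heq' := congrArg (fun Z => x ∈ Z) heq
      simp only [Finset.mem_filter, Finset.mem_univ, true_and, lt_self_iff_false] at heq'
      rw [heq']
      exact hxy
  · intro x
    exact Nat.lt_succ_of_le (Finset.card_le_univ _)

theorem ffAux_rep_two {α : Type*} [PartialOrder α] [Fintype α] (s w : ℕ) (hs : 2 ≤ s)
    (hfree : ffFree α 2 s)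
    (hw : ∀ A : Finset α, IsAntichain (· ≤ ·) (A : Set α) → A.card ≤ w) :
    ffRep α ((s - 1) * w) := by
  classical
  obtain ⟨D, hD, hmono, hbd⟩ := ffAux_sigma α
  refine ⟨Fintype.card α + 1, fun x => {t | t = (D x).card ∨
    ((D x).card ≤ t ∧ ∃ u, ¬ x ≤ u ∧ ¬ u ≤ x ∧ t ≤ (D u).card)}, ?_, ?_, ?_, ?_, ?_⟩
  · rintro x t (rfl | ⟨_, u, _, _, h⟩)
    · exact hbd x
    · exact lt_of_le_of_lt h (hbd u)
  · intro x
    refine ⟨?_⟩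
    rintro a ha b hb t ⟨hat, htb⟩
    have hxa : (D x).card ≤ a := by
      rcases ha with h | h
      · exact h.ge
      · exact h.1
    rcases hb with hb | ⟨_, u, h1, h2, h3⟩
    · left; omega
    · right; exact ⟨hxa.trans hat, u, h1, h2, htb.trans h3⟩
  · intro x
    exact ⟨_, Or.inl rfl⟩
  · intro x y hxy hyx
    rcases le_total (D x).card (D y).card with h | h
    · exact ⟨(D y).card, Or.inr ⟨h, y, hxy, hyx, le_rfl⟩, Or.inl rfl⟩
    · exact ⟨(D x).card, Or.inl rfl, Or.inr ⟨h, x, hyx, hxy, le_rfl⟩⟩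
  · intro t F hF
    refine ffAux_mirsky w hw (s - 1) F ?_
    intro T hTF hT
    by_contra hcard
    obtain ⟨X, hXT, hXc⟩ := Finset.exists_subset_card_eq (show s ≤ T.card by omega)
    have hX : IsChain (· ≤ ·) (X : Set α) := hT.mono (by exact_mod_cast hXT)
    have hXne : X.Nonempty := Finset.card_pos.mp (by omega)
    obtain ⟨a, haX, ha⟩ := ffAux_least X hX hXne
    obtain ⟨b, hbX, hb⟩ := ffAux_greatest X hX hXne
    have hσ : ∀ x ∈ X, (D x).card ≤ t := by
      intro x hx
      rcases hF x (hTF (hXT hx)) with h | h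
      · exact h.ge
      · exact h.1
    have hab : a < b := by
      refine lt_of_le_of_ne (ha b hbX) ?_
      rintro rfl
      have : X ⊆ {a} := fun x hx => Finset.mem_singleton.mpr (le_antisymm (hb x hx) (ha x hx))
      have := Finset.card_le_card this
      simp at this
      omega
    have hlt := hmono a b hab
    have hbt := hσ b hbX
    rcases hF a (hTF (hXT haX)) with h | ⟨_, u, hau, hua, htu⟩
    · omega
    have hux : ∀ x ∈ X, ¬ u ≤ x ∧ ¬ x ≤ u := by
      intro x hx
      have h2 : ¬ x ≤ u := fun h => hau ((ha x hx).trans h)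
      refine ⟨fun h => ?_, h2⟩
      have := hmono u x (lt_of_le_of_ne h (fun e => h2 e.ge))
      have := hσ x hx
      omega
    have hnot : ¬ D u ⊆ D b := by
      intro hsub
      have heq := Finset.eq_of_subset_of_card_le hsub (hbt.trans htu)
      have : a ∈ D u := by rw [heq]; exact (hD b a).mpr hab
      exact hau ((hD u a).mp this).le
    obtain ⟨l, hlu, hlb⟩ := Finset.not_subset.mp hnot
    rw [hD] at hlu hlb
    have hlx : ∀ x ∈ X, ¬ l ≤ x ∧ ¬ x ≤ l := by
      intro x hx
      have h2 : ¬ x ≤ l := fun h => (hux x hx).2 (h.trans hlu.le)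
      refine ⟨fun h => hlb ?_, h2⟩
      exact lt_of_lt_of_le (lt_of_le_of_ne h (fun e => h2 e.ge)) (hb x hx)
    refine hfree {l, u} X (Finset.card_pair hlu.ne) hXc ?_ hX ?_
    · rw [Finset.coe_pair]
      exact IsChain.pair hlu.le
    · intro p hp x hx
      rcases Finset.mem_insert.mp hp with rfl | hp
      · exact hlx x hx
      · rw [Finset.mem_singleton.mp hp]
        exact hux x hx

theorem ffAux_rep_general {α : Type*} [PartialOrder α] [Fintype α] (r s w : ℕ) (hr : 2 ≤ r)
    (hs : 2 ≤ s) (hfree : ffFree α r s)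
    (hw : ∀ A : Finset α, IsAntichain (· ≤ ·) (A : Set α) → A.card ≤ w) :
    ffRep α ((s - 1) * w + (r - 1) * w) := by
  classical
  obtain ⟨D, hD, hmono, hbd⟩ := ffAux_sigma α
  set σ : α → ℕ := fun x => (D x).card with hσ
  -- `E x t`: an `s`-chain with least element `x` lies in the part of level at most `t`
  set E : α → ℕ → Prop := fun x t => ∃ X : Finset α, X.card = s ∧ IsChain (· ≤ ·) (X : Set α) ∧
    x ∈ X ∧ ∀ y ∈ X, x ≤ y ∧ σ y ≤ t with hE
  have hEmono : ∀ x a b, a ≤ b → E x a → E x b := by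
    rintro x a b hab ⟨X, h1, h2, h3, h4⟩
    exact ⟨X, h1, h2, h3, fun y hy => ⟨(h4 y hy).1, (h4 y hy).2.trans hab⟩⟩
  have hEself : ∀ x, ¬ E x (σ x) := by
    rintro x ⟨X, h1, h2, h3, h4⟩
    have : X ⊆ {x} := by
      intro y hy
      rw [Finset.mem_singleton]
      by_contra hne
      have := hmono x y (lt_of_le_of_ne (h4 y hy).1 (Ne.symm hne))
      have := (h4 y hy).2
      simp only [hσ] at this
      omega
    have := Finset.card_le_card this
    simp at this
    omega
  set N := Fintype.card α + 1 with hN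
  set I : α → Set ℕ := fun x => {t | (σ x ≤ t ∧ t < N ∧ ¬ E x t) ∨
    (t < σ x ∧ ∃ y, ¬ x ≤ y ∧ ¬ y ≤ x ∧ E y (t + 1))} with hI
  have hself : ∀ x, σ x ∈ I x := fun x => Or.inl ⟨le_rfl, hbd x, hEself x⟩
  have hmeet : ∀ x y, ¬ x ≤ y → ¬ y ≤ x → σ x ≤ σ y → (I x ∩ I y).Nonempty := by
    intro x y hxy hyx hle
    by_cases hEx : E x (σ y)
    · have hex : ∃ t, E x t := ⟨_, hEx⟩
      have hf := Nat.find_spec hex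
      have hfle := Nat.find_min' hex hEx
      have hgt : σ x < Nat.find hex := by
        by_contra hcon
        exact hEself x (hEmono x _ _ (not_lt.mp hcon) hf)
      have hNy := hbd y
      obtain ⟨T, hT⟩ : ∃ T, Nat.find hex = T + 1 := ⟨Nat.find hex - 1, by omega⟩
      have hTn : ¬ E x T := Nat.find_min hex (by omega)
      rw [hT] at hf hfle hgt
      refine ⟨T, Or.inl ⟨by omega, ?_, hTn⟩, Or.inr ⟨by omega, x, hyx, hxy, hf⟩⟩
      simp only [hσ] at hfle
      omega
    · exact ⟨σ y, Or.inl ⟨hle, hbd y, hEx⟩, hself y⟩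
  refine ⟨N, I, ?_, ?_, ?_, ?_, ?_⟩
  · rintro x t (h | h)
    · exact h.2.1
    · exact h.1.trans (hbd x)
  · intro x
    refine ⟨?_⟩
    rintro a ha b hb t ⟨hat, htb⟩
    rcases Nat.lt_or_ge t (σ x) with h | h
    · right
      rcases ha with ha | ⟨_, y, h1, h2, h3⟩
      · omega
      · exact ⟨h, y, h1, h2, hEmono y _ _ (by omega) h3⟩
    · left
      rcases hb with ⟨_, h2, h3⟩ | hb
      · exact ⟨h, by omega, fun hh => h3 (hEmono x _ _ htb hh)⟩
      · omega
  · exact fun x => ⟨_, hself x⟩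
  · intro x y hxy hyx
    rcases le_total (σ x) (σ y) with h | h
    · exact hmeet x y hxy hyx h
    · rw [Set.inter_comm]
      exact hmeet y x hyx hxy h
  · intro t F hF
    have h1 : (F.filter (fun x => σ x ≤ t)).card ≤ (s - 1) * w := by
      refine ffAux_mirsky w hw (s - 1) _ ?_
      intro T hTF hT
      by_contra hcard
      obtain ⟨X, hXT, hXc⟩ := Finset.exists_subset_card_eq (show s ≤ T.card by omega)
      have hX : IsChain (· ≤ ·) (X : Set α) := hT.mono (by exact_mod_cast hXT)
      obtain ⟨a, haX, ha⟩ := ffAux_least X hX (Finset.card_pos.mp (by omega))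
      have haF := Finset.mem_filter.mp (hTF (hXT haX))
      rcases hF a haF.1 with h | h
      · exact h.2.2 ⟨X, hXc, hX, haX, fun y hy =>
          ⟨ha y hy, (Finset.mem_filter.mp (hTF (hXT hy))).2⟩⟩
      · have := haF.2
        omega
    have h2 : (F.filter (fun x => ¬ σ x ≤ t)).card ≤ (r - 1) * w := by
      refine ffAux_mirsky w hw (r - 1) _ ?_
      intro T hTF hT
      by_contra hcard
      obtain ⟨U, hUT, hUc⟩ := Finset.exists_subset_card_eq (show r ≤ T.card by omega)
      have hU : IsChain (· ≤ ·) (U : Set α) := hT.mono (by exact_mod_cast hUT)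
      obtain ⟨b, hbU, hb⟩ := ffAux_greatest U hU (Finset.card_pos.mp (by omega))
      have hbF := Finset.mem_filter.mp (hTF (hUT hbU))
      rcases hF b hbF.1 with h | ⟨_, x, hbx, hxb, X, hXc, hX, hxX, hXx⟩
      · exact hbF.2 h.1
      · refine hfree U X hUc hXc hU hX ?_
        intro u hu y hy
        have hn : ¬ y ≤ u := fun h => hxb ((hXx y hy).1.trans (h.trans (hb u hu)))
        refine ⟨fun h => ?_, hn⟩
        have h3 := hmono u y (lt_of_le_of_ne h (fun e => hn e.ge))
        have h4 := (hXx y hy).2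
        have h5 := (Finset.mem_filter.mp (hTF (hUT hu))).2
        simp only [hσ] at h4 h5
        omega
    rw [← Finset.card_filter_add_card_filter_not (s := F) (fun x => σ x ≤ t)]
    omega

theorem ffRep_mono {α : Type*} [PartialOrder α] {K K' : ℕ} (h : K ≤ K') (hrep : ffRep α K) :
    ffRep α K' := by
  obtain ⟨N, I, h1, h2, h3, h4, h5⟩ := hrep
  exact ⟨N, I, h1, h2, h3, h4, fun t F hF => (h5 t F hF).trans h⟩

theorem ffAux_rep {α : Type*} [PartialOrder α] [Fintype α] (r s w : ℕ) (hr : 2 ≤ r)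
    (hs : 2 ≤ s) (hfree : ffFree α r s)
    (hw : ∀ A : Finset α, IsAntichain (· ≤ ·) (A : Set α) → A.card ≤ w) :
    ffRep α ((r - 1) * (s - 1) * w) := by
  obtain ⟨a, rfl⟩ : ∃ a, r = a + 2 := ⟨r - 2, by omega⟩
  obtain ⟨b, rfl⟩ : ∃ b, s = b + 2 := ⟨s - 2, by omega⟩
  rcases Nat.eq_zero_or_pos a with rfl | ha
  · exact ffRep_mono (by simp) (ffAux_rep_two (b + 2) w hs hfree hw)
  rcases Nat.eq_zero_or_pos b with rfl | hb
  · refine ffRep_mono (by simp) (ffAux_rep_two (a + 2) w hr ?_ hw)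
    intro A B hA hB hAc hBc h
    exact hfree B A hB hA hBc hAc (fun x hx y hy => (h y hy x hx).symm)
  · refine ffRep_mono ?_ (ffAux_rep_general (a + 2) (b + 2) w hr hs hfree hw)
    rw [← add_mul]
    apply Nat.mul_le_mul_right
    have : a + 2 - 1 = a + 1 := rfl
    have : b + 2 - 1 = b + 1 := rfl
    simp only [*]
    nlinarith [Nat.mul_le_mul ha hb]

/-- **First-Fit is linear on `(𝐫+𝐬)`-free posets.**
Let `r, s ≥ 2`, let `P` (here the finite partial order `α`) be an `(𝐫+𝐬)`-free poset of
width `w`, and let `C 0, …, C (m-1)` be a First-Fit chain partition of `P`.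
Then `m ≤ 8 * (r-1) * (s-1) * w`. -/
theorem firstFit_linear_on_two_long_incomparable_chains_free
    {α : Type*} [PartialOrder α] [Fintype α]
    (r s w m : ℕ) (hr : 2 ≤ r) (hs : 2 ≤ s)
    -- `P` is `(𝐫 + 𝐬)`-free
    (hfree : ¬ ∃ A B : Finset α, A.card = r ∧ B.card = s ∧ Disjoint A B ∧
      IsChain (· ≤ ·) (A : Set α) ∧ IsChain (· ≤ ·) (B : Set α) ∧
      ∀ a ∈ A, ∀ b ∈ B, ¬ a ≤ b ∧ ¬ b ≤ a)
    -- `w` is the width of `P`: the maximum size of an antichain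
    (hw : IsGreatest {k | ∃ A : Finset α, A.card = k ∧ IsAntichain (· ≤ ·) (A : Set α)} w)
    -- `C` is a First-Fit chain partition of `P` into `m` chains
    (C : Fin m → Set α)
    (hCne : ∀ i, (C i).Nonempty)
    (hCchain : ∀ i, IsChain (· ≤ ·) (C i))
    (hCdisj : ∀ i j, i ≠ j → Disjoint (C i) (C j))
    (hCcover : ∀ x : α, ∃ i, x ∈ C i)
    (hFF : ∀ i j : Fin m, i < j → ∀ x ∈ C j, ∃ y ∈ C i, ¬ x ≤ y ∧ ¬ y ≤ x) :
    m ≤ 8 * (r - 1) * (s - 1) * w := by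
  rcases Nat.eq_zero_or_pos m with rfl | hm
  · exact Nat.zero_le _
  have hfree' : ffFree α r s := by
    intro A B hA hB hAc hBc h
    refine hfree ⟨A, B, hA, hB, ?_, hAc, hBc, h⟩
    rw [Finset.disjoint_left]
    intro x hx hx'
    exact (h x hx x hx').1 le_rfl
  have hw' : ∀ A : Finset α, IsAntichain (· ≤ ·) (A : Set α) → A.card ≤ w :=
    fun A hA => hw.2 ⟨A, rfl, hA⟩
  obtain ⟨N, I, h1, h2, h3, h4, h5⟩ := ffAux_rep r s w hr hs hfree' hw'
  choose c hc using hCcover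
  have huniq : ∀ x i, x ∈ C i → c x = i := by
    intro x i hx
    by_contra hne
    exact Set.disjoint_left.mp (hCdisj _ _ hne) (hc x) hx
  have := ffAux_column N m ((r - 1) * (s - 1) * w) I (fun x => (c x : ℕ)) h1 h2 h3 (by
    intro x i hi
    obtain ⟨y, hy, hxy, hyx⟩ := hFF ⟨i, hi.trans (c x).2⟩ (c x) hi x (hc x)
    exact ⟨y, by simp [huniq y _ hy], h4 x y hxy hyx⟩) (by
    obtain ⟨x, hx⟩ := hCne ⟨m - 1, by omega⟩
    refine ⟨x, ?_⟩
    simp only [huniq x _ hx]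
    omega) h5
  calc m ≤ 8 * ((r - 1) * (s - 1) * w) := this
    _ = 8 * (r - 1) * (s - 1) * w := by ring
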